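/- Let G be a 2-connected plane graph with a clean embedding and let Z be an anchor of G. Let F' be a set of faces of G each of length at least 3. Then the number of branches in the dual graph G° with both endpoints in F' is at most 3|F'| + |Z|. -/

import Mathlib

/-- A loopless-or-not multigraph on vertex type `V` with edge type `E`:
each edge has a pair of endpoints. -/
structure Multigraph (V E : Type) where
  ends : E → Sym2 V

namespace Multigraph

variable {V E : Type}

/-- A multigraph is loopless if no edge has equal endpoints. -/
def Loopless (G : Multigraph V E) : Prop := ∀ e, ¬ (G.ends e).IsDiag

/-- The degree of a vertex: the number of edges incident with it. -/
noncomputable def degree (G : Multigraph V E) (v : V) : ℕ :=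
  Set.ncard {e : E | v ∈ G.ends e}

/-- Two (distinct) vertices are adjacent if some edge joins them. -/
def Adj (G : Multigraph V E) (u v : V) : Prop := u ≠ v ∧ ∃ e, G.ends e = s(u, v)

/-- One adjacency step avoiding a vertex set `A` and an edge set `S`. -/
def AdjAvoid (G : Multigraph V E) (A : Set V) (S : Set E) (u v : V) : Prop :=
  u ∉ A ∧ v ∉ A ∧ ∃ e, e ∉ S ∧ G.ends e = s(u, v)

/-- Reachability in the graph obtained by deleting the vertices `A` and edges `S`. -/
def Reach (G : Multigraph V E) (A : Set V) (S : Set E) : V → V → Prop :=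
  Relation.ReflTransGen (G.AdjAvoid A S)

/-- The graph minus the vertex set `A` is connected. -/
def ConnectedAvoiding (G : Multigraph V E) (A : Set V) : Prop :=
  ∀ u v : V, u ∉ A → v ∉ A → G.Reach A ∅ u v

def Connected (G : Multigraph V E) : Prop := G.ConnectedAvoiding ∅

def TwoConnected (G : Multigraph V E) : Prop :=
  3 ≤ Nat.card V ∧ ∀ x : V, G.ConnectedAvoiding {x}

/-- `{f, g}` is a 2-edge-cut: removing both destroys some reachability. -/
def IsTwoEdgeCut (G : Multigraph V E) (f g : E) : Prop :=
  f ≠ g ∧ ∃ u v : V, G.Reach ∅ ∅ u v ∧ ¬ G.Reach ∅ {f, g} u v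

/-- `{u, v}` is a 2-vertex-cut. -/
def IsVertexCut2 (G : Multigraph V E) (u v : V) : Prop :=
  u ≠ v ∧ ∃ x y : V, x ∉ ({u, v} : Set V) ∧ y ∉ ({u, v} : Set V) ∧ ¬ G.Reach {u, v} ∅ x y

/-- `K` is (the vertex set of) a connected component of `G − A`. -/
def IsCompAvoiding (G : Multigraph V E) (A : Set V) (K : Set V) : Prop :=
  ∃ x, x ∉ A ∧ K = {y | y ∉ A ∧ G.Reach A ∅ x y}

/-- `Z` is an anchor: no vertex of `Z` lies in a 2-vertex-cut, and every
nontrivial bridge (i.e. component of `G − {u,v}`) of every 2-vertex-cut `{u,v}`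
contains a vertex of `Z`. -/
def IsAnchor (G : Multigraph V E) (Z : Set V) : Prop :=
  (∀ z ∈ Z, ∀ u v : V, G.IsVertexCut2 u v → z ≠ u ∧ z ≠ v) ∧
  (∀ u v : V, G.IsVertexCut2 u v → ∀ K : Set V, G.IsCompAvoiding {u, v} K → ∃ z ∈ Z, z ∈ K)

/-- A (simple) path from `u` to `v` in a multigraph: a list of pairwise distinct
vertices together with the list of edges joining the consecutive vertices. -/
structure MPath (G : Multigraph V E) (u v : V) where
  verts : List V
  edges : List E
  len_eq : verts.length = edges.length + 1
  head_eq : verts.head? = some u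
  last_eq : verts.getLast? = some v
  ends_eq : ∀ i : ℕ, (hi : i < edges.length) →
    G.ends (edges.get ⟨i, hi⟩) =
      s(verts.get ⟨i, by omega⟩, verts.get ⟨i + 1, by omega⟩)
  vnodup : verts.Nodup
  enodup : edges.Nodup

/-- The internal vertices of a path: all vertices but the two endpoints. -/
def MPath.internal {G : Multigraph V E} {u v : V} (p : G.MPath u v) : List V :=
  (p.verts.drop 1).dropLast

/-- A branch: a nontrivial path whose endpoints have degree at least 3 and
whose internal vertices have degree 2. -/
def IsBranchPath (G : Multigraph V E) {u v : V} (p : G.MPath u v) : Prop :=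
  p.edges ≠ [] ∧ 3 ≤ G.degree u ∧ 3 ≤ G.degree v ∧ ∀ w ∈ p.internal, G.degree w = 2

/-- The edge sets of branches with both endpoints in `B` (a branch is determined,
up to reversal, by its edge set). -/
def branchSets (G : Multigraph V E) (B : Set V) : Set (Set E) :=
  {S | ∃ u v, u ∈ B ∧ v ∈ B ∧ ∃ p : G.MPath u v, G.IsBranchPath p ∧ {e | e ∈ p.edges} = S}

/-- An `(ℓ, Δ)`-earring: a base edge `uv` plus two distinct `uv`-paths avoiding the
base edge, of length at most `ℓ`, with internal vertices of degree `< Δ`, and such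
that every common edge `f` of the two paths makes `{base, f}` a 2-edge-cut. -/
structure Earring (G : Multigraph V E) (ℓ Δ : ℕ) where
  base : E
  u : V
  v : V
  une : u ≠ v
  ends_base : G.ends base = s(u, v)
  P : G.MPath u v
  Q : G.MPath u v
  PQ_distinct : P.verts ≠ Q.verts ∨ P.edges ≠ Q.edges
  base_not_P : base ∉ P.edges
  base_not_Q : base ∉ Q.edges
  lenP : P.edges.length ≤ ℓ
  lenQ : Q.edges.length ≤ ℓ
  degP : ∀ w ∈ P.internal, G.degree w < Δ
  degQ : ∀ w ∈ Q.internal, G.degree w < Δ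
  common_cut : ∀ f, f ∈ P.edges → f ∈ Q.edges → G.IsTwoEdgeCut base f

def Earring.edgeSet {G : Multigraph V E} {ℓ Δ : ℕ} (X : G.Earring ℓ Δ) : Set E :=
  {X.base} ∪ {e | e ∈ X.P.edges} ∪ {e | e ∈ X.Q.edges}

def Earring.vertexSet {G : Multigraph V E} {ℓ Δ : ℕ} (X : G.Earring ℓ Δ) : Set V :=
  {w | w ∈ X.P.verts ∨ w ∈ X.Q.verts}

/-- A drawing of a multigraph in the plane: an injective placement of the vertices
together with, for each edge, a simple arc joining the placements of its endpoints,
whose interior avoids all vertices. -/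
structure Drawing (G : Multigraph V E) where
  vpos : V → ℝ × ℝ
  arc : E → ℝ → ℝ × ℝ
  vpos_inj : Function.Injective vpos
  arc_cont : ∀ e, ContinuousOn (arc e) (Set.Icc 0 1)
  arc_inj : ∀ e, Set.InjOn (arc e) (Set.Icc 0 1)
  arc_ends : ∀ e, ∃ x y : V, G.ends e = s(x, y) ∧ arc e 0 = vpos x ∧ arc e 1 = vpos y
  arc_avoid : ∀ e, ∀ t ∈ Set.Ioo (0:ℝ) 1, ∀ x : V, arc e t ≠ vpos x

/-- The (doubly counted) set of crossings of a drawing: interior points where two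
distinct edges meet. -/
def Drawing.CrossSet {G : Multigraph V E} (D : G.Drawing) : Set ((E × E) × ℝ × ℝ) :=
  {q | q.1.1 ≠ q.1.2 ∧ q.2.1 ∈ Set.Ioo (0:ℝ) 1 ∧ q.2.2 ∈ Set.Ioo (0:ℝ) 1 ∧
    D.arc q.1.1 q.2.1 = D.arc q.1.2 q.2.2}

/-- A good drawing: one with finitely many crossings. -/
structure GoodDrawing (G : Multigraph V E) extends G.Drawing where
  finCross : toDrawing.CrossSet.Finite

/-- The number of crossings of a good drawing (each crossing is recorded twice
in `CrossSet`). -/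
noncomputable def GoodDrawing.crossings {G : Multigraph V E} (D : G.GoodDrawing) : ℕ :=
  D.toDrawing.CrossSet.ncard / 2

/-- The crossing number: the least number of crossings of a drawing. -/
noncomputable def crNum (G : Multigraph V E) : ℕ :=
  sInf {n : ℕ | ∃ D : G.GoodDrawing, D.crossings = n}

/-- A multigraph is planar if it has a crossing-free drawing. -/
def IsPlanar (G : Multigraph V E) : Prop := ∃ D : G.Drawing, D.CrossSet = ∅

/-- Deleting a set of edges. -/
def delete (G : Multigraph V E) (S : Set E) : Multigraph V {e : E // e ∉ S} :=
  ⟨fun e => G.ends e.1⟩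

/-- The image (point set) of a drawing in the plane. -/
def Drawing.image {G : Multigraph V E} (D : G.Drawing) : Set (ℝ × ℝ) :=
  Set.range D.vpos ∪ ⋃ e : E, D.arc e '' Set.Icc 0 1

/-- The faces of a drawing: the connected components of the complement of its image. -/
def Drawing.Faces {G : Multigraph V E} (D : G.Drawing) : Set (Set (ℝ × ℝ)) :=
  {C | ∃ p ∉ D.image, C = connectedComponentIn D.imageᶜ p}

/-- A vertex is incident with a face if its placement lies on the face's closure. -/
def Drawing.FaceIncident {G : Multigraph V E} (D : G.Drawing) (x : V) (C : Set (ℝ × ℝ)) :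
    Prop := D.vpos x ∈ closure C

/-- The weighted number of crossings of a good drawing. -/
noncomputable def GoodDrawing.wcross {G : Multigraph V E} (D : G.GoodDrawing)
    (w : E → ℝ) : ℝ :=
  (∑ q ∈ D.finCross.toFinset, w q.1.1 * w q.1.2) / 2

/-- The weighted crossing number of `(G, w)`. -/
noncomputable def wcr (G : Multigraph V E) (w : E → ℝ) : ℝ :=
  sInf {x : ℝ | ∃ D : G.GoodDrawing, D.wcross w = x}

end Multigraph

/-- The uniform probability measure on `[0,1]^E`, modelling i.i.d. uniform `[0,1]`
weights on the edges. -/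
noncomputable def cubeMeasure (E : Type) [Fintype E] : MeasureTheory.Measure (E → ℝ) :=
  (MeasureTheory.volume : MeasureTheory.Measure (E → ℝ)).restrict
    {w | ∀ e, w e ∈ Set.Icc (0:ℝ) 1}

/-- A combinatorial map (graph embedded in an orientable surface), given by the
rotation permutation `σ` and the fixed-point-free edge involution `α` on darts. -/
structure CombMap (D : Type) [Fintype D] where
  σ : Equiv.Perm D
  α : Equiv.Perm D
  α_invol : ∀ d, α (α d) = d
  α_ne : ∀ d, α d ≠ d

namespace CombMap

variable {D : Type} [Fintype D] (M : CombMap D)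

/-- Darts in the same `σ`-orbit emanate from the same vertex. -/
def vSetoid : Setoid D :=
  ⟨M.σ.SameCycle, ⟨fun _ => Equiv.Perm.SameCycle.refl _ _, fun h => h.symm,
    fun h h' => h.trans h'⟩⟩

def Vertices := Quotient M.vSetoid

def vmk (d : D) : M.Vertices := Quotient.mk M.vSetoid d

/-- The face permutation. -/
def φ : Equiv.Perm D := M.σ * M.α

/-- Darts in the same `φ`-orbit lie on the same face. -/
def fSetoid : Setoid D :=
  ⟨M.φ.SameCycle, ⟨fun _ => Equiv.Perm.SameCycle.refl _ _, fun h => h.symm,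
    fun h h' => h.trans h'⟩⟩

def Faces := Quotient M.fSetoid

def fmk (d : D) : M.Faces := Quotient.mk M.fSetoid d

/-- The degree of the vertex at a dart `d`: the number of darts at that vertex. -/
noncomputable def degreeD (d : D) : ℕ := Set.ncard {d' | M.σ.SameCycle d d'}

/-- The length of the face at a dart `d`: the length of its boundary walk. -/
noncomputable def faceLenD (d : D) : ℕ := Set.ncard {d' | M.φ.SameCycle d d'}

noncomputable def nV : ℕ := Nat.card M.Vertices
noncomputable def nF : ℕ := Nat.card M.Faces
noncomputable def nE (_M : CombMap D) : ℕ := Fintype.card D / 2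

/-- Connectedness of the map. -/
def Conn : Prop :=
  ∀ d d' : D, Relation.ReflTransGen (fun a b => b = M.σ a ∨ b = M.α a) d d'

/-- Euler's formula with characteristic 2: the map is an embedding in the plane
(sphere). -/
def EulerPlanar : Prop := (M.nV : ℤ) + M.nF = M.nE + 2

/-- No loops. -/
def NoLoops : Prop := ∀ d, ¬ M.σ.SameCycle d (M.α d)

/-- Simple: no loops and no parallel edges. -/
def Simple : Prop := M.NoLoops ∧
  ∀ d d', M.σ.SameCycle d d' → M.σ.SameCycle (M.α d) (M.α d') → d' = d

/-- Two darts lie on the same edge iff they are equal or `α`-related. -/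
def eSetoid : Setoid D :=
  ⟨fun d d' => d' = d ∨ d' = M.α d, by
    refine ⟨fun d => Or.inl rfl, ?_, ?_⟩
    · rintro x y (rfl | rfl)
      · exact Or.inl rfl
      · exact Or.inr (M.α_invol x).symm
    · rintro x y z (rfl | rfl) (rfl | rfl)
      · exact Or.inl rfl
      · exact Or.inr rfl
      · exact Or.inr rfl
      · exact Or.inl (M.α_invol x)⟩

def Edges := Quotient M.eSetoid

def emk (d : D) : M.Edges := Quotient.mk M.eSetoid d

/-- The underlying multigraph of a combinatorial map. -/
def toMultigraph : Multigraph M.Vertices M.Edges :=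
  ⟨Quotient.lift (fun d => s(M.vmk d, M.vmk (M.α d))) (by
    rintro d d' (rfl | rfl)
    · rfl
    · show s(M.vmk d, M.vmk (M.α d)) = s(M.vmk (M.α d), M.vmk (M.α (M.α d)))
      rw [M.α_invol]
      exact Sym2.eq_swap)⟩

/-- The dual map: faces become vertices. -/
def dual : CombMap D := ⟨M.φ, M.α, M.α_invol, M.α_ne⟩

/-- The set of parallel edges joining `u` and `v`. -/
def parallels (u v : M.Vertices) : Set M.Edges :=
  {e | M.toMultigraph.ends e = s(u, v)}

/-- Cleanness of the embedding: each class of `k ≥ 2` pairwise parallel edges is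
drawn consecutively, i.e. bounds `k − 1` faces of length 2 consisting solely of
edges of the class. -/
def IsClean : Prop :=
  ∀ u v : M.Vertices, u ≠ v → 2 ≤ (M.parallels u v).ncard →
    Set.ncard {f : M.Faces | ∃ d, M.fmk d = f ∧ M.faceLenD d = 2 ∧
      ∀ d', M.φ.SameCycle d d' → M.emk d' ∈ M.parallels u v} =
      (M.parallels u v).ncard - 1

end CombMap

namespace Multigraph

variable {V E : Type} {H : Multigraph V E} {u v : V}

lemma MPath.verts_zero (p : H.MPath u v) :
    p.verts[0]'(by have := p.len_eq; omega) = u := by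
  have h := p.head_eq
  rw [List.head?_eq_getElem?, List.getElem?_eq_getElem (by have := p.len_eq; omega)] at h
  exact Option.some.inj h

lemma MPath.verts_length (p : H.MPath u v) :
    p.verts[p.edges.length]'(by have := p.len_eq; omega) = v := by
  have h := p.last_eq
  rw [List.getLast?_eq_getElem?, List.getElem?_eq_getElem (by have := p.len_eq; omega)] at h
  have h := Option.some.inj h
  simpa [p.len_eq] using h

lemma MPath.ends_getElem (p : H.MPath u v) (i : ℕ) (hi : i < p.edges.length) :
    H.ends p.edges[i] = s(p.verts[i]'(by have := p.len_eq; omega),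
      p.verts[i + 1]'(by have := p.len_eq; omega)) :=
  p.ends_eq i hi

lemma MPath.not_isDiag_ends (p : H.MPath u v) {e : E} (he : e ∈ p.edges) :
    ¬ (H.ends e).IsDiag := by
  obtain ⟨i, hi, rfl⟩ := List.mem_iff_getElem.1 he
  rw [p.ends_getElem i hi, Sym2.mk_isDiag_iff, p.vnodup.getElem_inj_iff]
  omega

lemma MPath.getElem_mem_internal (p : H.MPath u v) (i : ℕ) (hi : i + 1 < p.edges.length) :
    p.verts[i + 1]'(by have := p.len_eq; omega) ∈ p.internal := by
  have := p.len_eq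
  rw [MPath.internal, List.mem_iff_getElem]
  refine ⟨i, by simp; omega, ?_⟩
  simp

/-- Every edge at a vertex of degree 2 that meets a branch belongs to the branch. -/
lemma IsBranchPath.mem_edges_of_mem_ends [Finite E] {p : H.MPath u v} (hp : H.IsBranchPath p)
    {e e' : E} {x : V} (he : e ∈ p.edges) (hx : x ∈ H.ends e) (hdeg : H.degree x = 2)
    (hx' : x ∈ H.ends e') : e' ∈ p.edges := by
  have hlen := p.len_eq
  obtain ⟨j, hj, hjx⟩ : ∃ j, ∃ hj : j < p.verts.length, p.verts[j] = x := by
    obtain ⟨i, hi, rfl⟩ := List.mem_iff_getElem.1 he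
    rw [p.ends_getElem i hi, Sym2.mem_iff] at hx
    rcases hx with h | h
    exacts [⟨i, _, h.symm⟩, ⟨i + 1, _, h.symm⟩]
  have h0 : j ≠ 0 := by
    rintro rfl
    have h1 := hp.2.1
    rw [← p.verts_zero, hjx] at h1
    omega
  have hn : j ≠ p.edges.length := by
    rintro rfl
    have h1 := hp.2.2.1
    rw [← p.verts_length, hjx] at h1
    omega
  obtain ⟨i, rfl⟩ := Nat.exists_eq_succ_of_ne_zero h0
  have hne : p.edges[i]'(by omega) ≠ p.edges[i + 1]'(by omega) := by
    rw [Ne, p.enodup.getElem_inj_iff]; omega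
  have hsub : ({p.edges[i]'(by omega), p.edges[i + 1]'(by omega)} : Set E) ⊆
      {e | x ∈ H.ends e} := by
    rintro e (rfl | rfl)
    · simp [p.ends_getElem i (by omega), ← hjx]
    · simp [p.ends_getElem (i + 1) (by omega), ← hjx]
  have heq := Set.eq_of_subset_of_ncard_le hsub (by rw [Set.ncard_pair hne]; exact hdeg.le)
  have hmem : e' ∈ ({p.edges[i]'(by omega), p.edges[i + 1]'(by omega)} : Set E) := by
    rw [heq]; exact hx'
  rcases hmem with rfl | rfl <;> exact List.getElem_mem _

/-- A property passing between distinct non-loop edges that share a vertex of degree 2 holds on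
all of a branch as soon as it holds somewhere on it. -/
lemma IsBranchPath.forall_mem_edges {p : H.MPath u v} (hp : H.IsBranchPath p) {C : E → Prop}
    (hC : ∀ e e' x, H.degree x = 2 → e ≠ e' → x ∈ H.ends e → x ∈ H.ends e' →
      ¬ (H.ends e).IsDiag → ¬ (H.ends e').IsDiag → C e → C e')
    {e : E} (he : e ∈ p.edges) (hCe : C e) : ∀ e' ∈ p.edges, C e' := by
  have hlen := p.len_eq
  have step : ∀ i, ∀ hi : i + 1 < p.edges.length,
      (C (p.edges[i]'(by omega)) ↔ C p.edges[i + 1]) := by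
    intro i hi
    have hne : p.edges[i]'(by omega) ≠ p.edges[i + 1]'(by omega) := by
      rw [Ne, p.enodup.getElem_inj_iff]; omega
    have hdeg := hp.2.2.2 _ (p.getElem_mem_internal i hi)
    have h1 : p.verts[i + 1] ∈ H.ends (p.edges[i]'(by omega)) := by
      simp [p.ends_getElem i (by omega)]
    have h2 : p.verts[i + 1] ∈ H.ends (p.edges[i + 1]'(by omega)) := by
      simp [p.ends_getElem (i + 1) (by omega)]
    have h3 := p.not_isDiag_ends (p.edges.getElem_mem (n := i) (by omega))
    have h4 := p.not_isDiag_ends (p.edges.getElem_mem (n := i + 1) (by omega))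
    exact ⟨hC _ _ _ hdeg hne h1 h2 h3 h4, hC _ _ _ hdeg hne.symm h2 h1 h4 h3⟩
  have base : ∀ i, ∀ hi : i < p.edges.length,
      (C (p.edges[0]'(by omega)) ↔ C p.edges[i]) := by
    intro i
    induction i with
    | zero => exact fun _ => Iff.rfl
    | succ i ih => exact fun hi => (ih (by omega)).trans (step i hi)
  obtain ⟨i, hi, rfl⟩ := List.mem_iff_getElem.1 he
  intro e' he'
  obtain ⟨j, hj, rfl⟩ := List.mem_iff_getElem.1 he'
  exact (base j hj).1 ((base i hi).2 hCe)

/-- Modulo 2, the boundary of a path is the sum of its endpoints. -/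
lemma MPath.sum_boundary [DecidableEq V] [DecidableEq E] (p : H.MPath u v)
    (β : E → V → ZMod 2)
    (hβ : ∀ e a b, H.ends e = s(a, b) → β e = Pi.single a 1 + Pi.single b 1) :
    ∑ e ∈ p.edges.toFinset, β e = Pi.single u 1 + Pi.single v 1 := by
  have hlen := p.len_eq
  have hself : ∀ g : V → ZMod 2, g + g = 0 :=
    fun g => funext fun _ => CharTwo.add_self_eq_zero _
  have key : ∀ n, ∀ hn : n ≤ p.edges.length,
      ((p.edges.take n).map β).sum =
        Pi.single u 1 + Pi.single (p.verts[n]'(by omega)) 1 := by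
    intro n
    induction n with
    | zero =>
      intro _
      rw [p.verts_zero, hself]
      simp
    | succ n ih =>
      intro hn
      rw [List.take_succ_eq_append_getElem (by omega), List.map_append, List.sum_append,
        ih (by omega), List.map_singleton, List.sum_singleton,
        hβ _ _ _ (p.ends_getElem n (by omega)), add_assoc, ← add_assoc (Pi.single p.verts[n] 1),
        hself, zero_add]
  have := key _ le_rfl
  rw [List.take_length, p.verts_length] at this
  rw [← this, List.sum_toFinset _ p.enodup]

/-- Deleting vertices that cover all edges leaving `W` traps walks starting in `W`. -/
lemma mem_of_reach_of_cover {G : Multigraph V E} {W A : Set V}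
    (hA : ∀ e a b, G.ends e = s(a, b) → a ∈ W → b ∉ W → a ∈ A ∨ b ∈ A)
    {x y : V} (hx : x ∈ W) (h : G.Reach A ∅ x y) : y ∈ W := by
  induction h with
  | refl => exact hx
  | tail _ hstep ih =>
    obtain ⟨ha, hb, e, -, he⟩ := hstep
    by_contra hc
    rcases hA e _ _ he ih hc with h | h
    exacts [ha h, hb h]

lemma TwoConnected.false_of_cover {G : Multigraph V E} (h2c : G.TwoConnected) {W : Set V} {a : V}
    (hA : ∀ e c d, G.ends e = s(c, d) → c ∈ W → d ∉ W → c = a ∨ d = a)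
    {x y : V} (hx : x ∈ W) (hy : y ∉ W) (hxa : x ≠ a) (hya : y ≠ a) : False :=
  hy (mem_of_reach_of_cover (A := {a}) hA hx (h2c.2 a x y hxa hya))

lemma IsAnchor.exists_mem_of_cover {G : Multigraph V E} {Z : Set V} (hZ : G.IsAnchor Z)
    {W : Set V} {a b : V} (hab : a ≠ b)
    (hA : ∀ e c d, G.ends e = s(c, d) → c ∈ W → d ∉ W →
      (c = a ∨ c = b) ∨ (d = a ∨ d = b))
    {x y : V} (hx : x ∈ W) (hy : y ∉ W) (hxa : x ≠ a) (hxb : x ≠ b) (hya : y ≠ a)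
    (hyb : y ≠ b) : ∃ z ∈ Z, z ∈ W := by
  have hxA : x ∉ ({a, b} : Set V) := by simp [hxa, hxb]
  have hyA : y ∉ ({a, b} : Set V) := by simp [hya, hyb]
  have hcut : G.IsVertexCut2 a b :=
    ⟨hab, x, y, hxA, hyA, fun h => hy (mem_of_reach_of_cover (A := {a, b}) hA hx h)⟩
  obtain ⟨z, hz, hzK⟩ := hZ.2 a b hcut _ ⟨x, hxA, rfl⟩
  exact ⟨z, hz, mem_of_reach_of_cover (A := {a, b}) hA hx hzK.2⟩

/-- In a 2-connected graph, the edges leaving a vertex set are not all parallel. -/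
lemma TwoConnected.exists_crossing_ne {G : Multigraph V E} (h2c : G.TwoConnected)
    {W : Set V} {x y : V} (hx : x ∈ W) (hy : y ∉ W) (q : Sym2 V) :
    ∃ e c d, G.ends e = s(c, d) ∧ c ∈ W ∧ d ∉ W ∧ G.ends e ≠ q := by
  by_contra! hcon
  have hfin : Finite V := Nat.finite_of_card_ne_zero (by have := h2c.1; omega)
  obtain ⟨t, htx, hty⟩ : ∃ t, t ≠ x ∧ t ≠ y := by
    by_contra! h
    have hle : Nat.card V ≤ ({x, y} : Set V).ncard := by
      rw [← Set.ncard_univ]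
      exact Set.ncard_le_ncard (fun t _ => or_iff_not_imp_left.2 (h t))
    have h1 := Set.ncard_insert_le x ({y} : Set V)
    rw [Set.ncard_singleton] at h1
    have := h2c.1
    omega
  by_cases hex : ∃ e c d, G.ends e = s(c, d) ∧ c ∈ W ∧ d ∉ W
  · obtain ⟨e₀, u, v, he₀, hu, hv⟩ := hex
    have hq := hcon _ _ _ he₀ hu hv
    have hends : ∀ e c d, G.ends e = s(c, d) → c ∈ W → d ∉ W → c = u ∧ d = v := by
      intro e c d he hc hd
      have h := hcon e c d he hc hd
      rw [he, ← hq, he₀, Sym2.eq_iff] at h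
      rcases h with h | ⟨rfl, rfl⟩
      · exact h
      · exact absurd hc hv
    have hW : ∀ x ∈ W, x = u := by
      intro x hx
      by_contra hne
      exact h2c.false_of_cover (a := u) (fun e c d he hc hd => Or.inl (hends e c d he hc hd).1)
        hx hv hne (fun h => hv (h ▸ hu))
    have hWc : ∀ y, y ∉ W → y = v := by
      intro y hy
      by_contra hne
      exact h2c.false_of_cover (a := v) (fun e c d he hc hd => Or.inr (hends e c d he hc hd).2)
        hu hy (fun h => hv (h ▸ hu)) hne
    by_cases ht : t ∈ W
    · exact htx ((hW t ht).trans (hW x hx).symm)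
    · exact hty ((hWc t ht).trans (hWc y hy).symm)
  · exact h2c.false_of_cover (a := t)
      (fun e c d he hc hd => absurd ⟨e, c, d, he, hc, hd⟩ hex) hx hy htx.symm hty.symm

/-- A vertex set left only by edges of two parallel classes contains an anchor vertex. -/
lemma IsAnchor.exists_mem_of_two_classes {G : Multigraph V E} (h2c : G.TwoConnected)
    (hcard : 4 ≤ Nat.card V) {Z : Set V} (hZ : G.IsAnchor Z) {W : Set V} {u v u' v' : V}
    (hu : u ∈ W) (hv : v ∉ W) (hu' : u' ∈ W) (hv' : v' ∉ W) (hne : s(u, v) ≠ s(u', v'))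
    (hends : ∀ e c d, G.ends e = s(c, d) → c ∈ W → d ∉ W →
      (c = u ∧ d = v) ∨ (c = u' ∧ d = v')) :
    ∃ z ∈ Z, z ∈ W := by
  have hfin : Finite V := Nat.finite_of_card_ne_zero (by omega)
  obtain ⟨hWne, hWne'⟩ : (∀ x ∈ W, ∀ y, y ∉ W → x ≠ y) ∧ (∀ x ∈ W, ∀ y, y ∉ W → y ≠ x) :=
    ⟨fun x hx y hy h => hy (h ▸ hx), fun x hx y hy h => hy (h ▸ hx)⟩
  have hfour : ∀ a b c : V, ∃ t, t ≠ a ∧ t ≠ b ∧ t ≠ c := by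
    intro a b c
    by_contra! h
    have hle : Nat.card V ≤ ({a, b, c} : Set V).ncard := by
      rw [← Set.ncard_univ]
      refine Set.ncard_le_ncard (fun t _ => ?_)
      by_contra ht
      simp only [Set.mem_insert_iff, Set.mem_singleton_iff, not_or] at ht
      exact ht.2.2 (h t ht.1 ht.2.1)
    have h1 := Set.ncard_insert_le a ({b, c} : Set V)
    have h2 := Set.ncard_insert_le b ({c} : Set V)
    rw [Set.ncard_singleton] at h2
    omega
  by_cases huu : u = u'
  · subst huu
    have hvv : v ≠ v' := fun h => hne (by rw [h])
    obtain ⟨y, hyu, hyv, hyv'⟩ := hfour u v v'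
    have hy : y ∉ W := fun hyW =>
      h2c.false_of_cover (a := u)
        (fun e c d he hc hd => Or.inl ((hends e c d he hc hd).elim And.left And.left))
        hyW hv hyu (hWne' _ hu _ hv)
    exact hZ.exists_mem_of_cover hvv
      (fun e c d he hc hd => Or.inr ((hends e c d he hc hd).imp And.right And.right))
      hu hy (hWne _ hu _ hv) (hWne _ hu _ hv') hyv hyv'
  · by_cases hex : ∃ y, y ∉ W ∧ y ≠ v'
    · obtain ⟨y, hy, hyv'⟩ := hex
      refine hZ.exists_mem_of_cover (hWne u hu v' hv') (fun e c d he hc hd => ?_)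
        hu' hy (Ne.symm huu) (hWne _ hu' _ hv') (hWne' _ hu _ hy) hyv'
      rcases hends e c d he hc hd with h | h
      exacts [Or.inl (Or.inl h.1), Or.inr (Or.inr h.2)]
    · push Not at hex
      obtain ⟨x, hxu, hxu', hxv'⟩ := hfour u u' v'
      have hx : x ∈ W := by
        by_contra h
        exact hxv' (hex x h)
      exact hZ.exists_mem_of_cover huu
        (fun e c d he hc hd => Or.inl ((hends e c d he hc hd).imp And.left And.left))
        hx hv' hxu hxu' (hWne' _ hu _ hv') (hWne' _ hu' _ hv')

end Multigraph

lemma Set.ncard_preimage_eq_two_mul {α β : Type*} [Finite α] [Finite β] (f : α → β) (s : Set β)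
    (h : ∀ b ∈ s, (f ⁻¹' {b}).ncard = 2) : (f ⁻¹' s).ncard = 2 * s.ncard := by
  classical
  have := Fintype.ofFinite α
  have := Fintype.ofFinite β
  have hmaps : ∀ a ∈ (f ⁻¹' s).toFinset, f a ∈ s.toFinset := by simp
  rw [Set.ncard_eq_toFinset_card', Set.ncard_eq_toFinset_card',
    Finset.card_eq_sum_card_fiberwise hmaps, Finset.sum_const_nat (m := 2), mul_comm]
  intro b hb
  have hb : b ∈ s := by simpa using hb
  rw [← h b hb, Set.ncard_eq_toFinset_card']
  congr 1
  ext a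
  simp only [Finset.mem_filter, Set.mem_toFinset, Set.mem_preimage, Set.mem_singleton_iff]
  exact ⟨fun h => h.2, fun h => ⟨h ▸ hb, h⟩⟩

namespace CombMap

variable {D : Type} [Fintype D] (M : CombMap D)

instance : Finite M.Vertices := inferInstanceAs (Finite (Quotient _))
instance : Finite M.Faces := inferInstanceAs (Finite (Quotient _))
instance : Finite M.Edges := inferInstanceAs (Finite (Quotient _))

/-- The underlying multigraph of the dual map, with the faces of `M` as its vertices. -/
def dualGraph : Multigraph M.Faces M.Edges := M.dual.toMultigraph

variable {M}

lemma emk_surjective : Function.Surjective M.emk := Quotient.mk_surjective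

lemma vmk_surjective : Function.Surjective M.vmk := Quotient.mk_surjective

lemma fmk_surjective : Function.Surjective M.fmk := Quotient.mk_surjective

lemma vmk_eq_iff {d d' : D} : M.vmk d = M.vmk d' ↔ M.σ.SameCycle d d' := Quotient.eq

lemma fmk_eq_iff {d d' : D} : M.fmk d = M.fmk d' ↔ M.φ.SameCycle d d' := Quotient.eq

lemma emk_eq_iff {d d' : D} : M.emk d = M.emk d' ↔ d' = d ∨ d' = M.α d := Quotient.eq

lemma emk_α (d : D) : M.emk (M.α d) = M.emk d := (emk_eq_iff.2 (Or.inr rfl)).symm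

lemma fmk_φ (d : D) : M.fmk (M.φ d) = M.fmk d :=
  (fmk_eq_iff.2 ((Equiv.Perm.SameCycle.refl _ _).apply_right)).symm

lemma vmk_φ (d : D) : M.vmk (M.φ d) = M.vmk (M.α d) :=
  (vmk_eq_iff.2 ((Equiv.Perm.SameCycle.refl _ _).apply_right)).symm

lemma ends_emk (d : D) : M.toMultigraph.ends (M.emk d) = s(M.vmk d, M.vmk (M.α d)) := rfl

lemma dualGraph_ends_emk (d : D) :
    M.dualGraph.ends (M.emk d) = s(M.fmk d, M.fmk (M.α d)) := rfl

lemma exists_dart_of_mem_dual_ends {x : M.Faces} {e : M.Edges} (h : x ∈ M.dualGraph.ends e) :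
    ∃ d, M.emk d = e ∧ M.fmk d = x := by
  obtain ⟨d, rfl⟩ := emk_surjective e
  rw [dualGraph_ends_emk, Sym2.mem_iff] at h
  rcases h with rfl | rfl
  exacts [⟨d, rfl, rfl⟩, ⟨M.α d, emk_α d, rfl⟩]

lemma fmk_mem_dual_ends (d : D) : M.fmk d ∈ M.dualGraph.ends (M.emk d) := by
  simp [dualGraph_ends_emk]

lemma ncard_emk_fiber (e : M.Edges) : (M.emk ⁻¹' {e}).ncard = 2 := by
  obtain ⟨d, rfl⟩ := emk_surjective e
  rw [← Set.ncard_pair (M.α_ne d).symm]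
  congr 1
  ext d'
  simp only [Set.mem_preimage, Set.mem_singleton_iff, Set.mem_insert_iff]
  rw [eq_comm, emk_eq_iff]

/-- Distinct non-loop dual edges sharing a dual vertex of degree 2 are parallel in the primal. -/
lemma ends_eq_of_dual_degree_two {e e' : M.Edges} {x : M.Faces} (hdeg : M.dualGraph.degree x = 2)
    (hne : e ≠ e') (hx : x ∈ M.dualGraph.ends e) (hx' : x ∈ M.dualGraph.ends e')
    (hl : ¬ (M.dualGraph.ends e).IsDiag) (hl' : ¬ (M.dualGraph.ends e').IsDiag) :
    M.toMultigraph.ends e = M.toMultigraph.ends e' := by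
  obtain ⟨d, rfl, hd⟩ := exists_dart_of_mem_dual_ends hx
  obtain ⟨d', rfl, hd'⟩ := exists_dart_of_mem_dual_ends hx'
  rw [dualGraph_ends_emk, Sym2.mk_isDiag_iff, hd] at hl
  rw [dualGraph_ends_emk, Sym2.mk_isDiag_iff, hd'] at hl'
  have hedges : {e | x ∈ M.dualGraph.ends e} = {M.emk d, M.emk d'} := by
    refine (Set.eq_of_subset_of_ncard_le ?_ ?_).symm
    · rintro e (rfl | rfl) <;> assumption
    · rw [Set.ncard_pair hne]; exact hdeg.le
  have hdarts : ∀ c, M.fmk c = x → c = d ∨ c = d' := by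
    intro c hc
    have hmem : M.emk c ∈ ({M.emk d, M.emk d'} : Set M.Edges) := by
      rw [← hedges, ← hc]; exact fmk_mem_dual_ends c
    rcases hmem with h | h
    · rcases emk_eq_iff.1 h.symm with h | rfl
      exacts [Or.inl h, absurd hc.symm hl]
    · rcases emk_eq_iff.1 h.symm with h | rfl
      exacts [Or.inr h, absurd hc.symm hl']
  have hdd : d ≠ d' := fun h => hne (by rw [h])
  have hcyc : M.φ.SameCycle d d' := fmk_eq_iff.1 (hd.trans hd'.symm)
  have h1 : M.φ d = d' := by
    rcases hdarts _ ((fmk_φ d).trans hd) with h | h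
    · exact absurd (hcyc.eq_of_left h) hdd
    · exact h
  have h2 : M.φ d' = d := by
    rcases hdarts _ ((fmk_φ d').trans hd') with h | h
    · exact h
    · exact absurd (hcyc.eq_of_right h) hdd
  rw [ends_emk, ends_emk, ← vmk_φ, ← vmk_φ, h1, h2, Sym2.eq_swap]

/-- All edges of a dual branch are parallel in the primal. -/
lemma ends_eq_of_mem_branchSets {B : Set M.Faces} {S : Set M.Edges}
    (hS : S ∈ M.dualGraph.branchSets B) {e e' : M.Edges} (he : e ∈ S) (he' : e' ∈ S) :
    M.toMultigraph.ends e = M.toMultigraph.ends e' := by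
  obtain ⟨u, v, -, -, p, hp, rfl⟩ := hS
  refine hp.forall_mem_edges (C := fun e' => M.toMultigraph.ends e = M.toMultigraph.ends e')
    ?_ he rfl e' he'
  intro a b x hdeg hne ha hb hla hlb h
  exact h.trans (ends_eq_of_dual_degree_two hdeg hne ha hb hla hlb)

lemma nonempty_of_mem_branchSets {B : Set M.Faces} {S : Set M.Edges}
    (hS : S ∈ M.dualGraph.branchSets B) : S.Nonempty := by
  obtain ⟨u, v, -, -, p, hp, rfl⟩ := hS
  exact List.exists_mem_of_ne_nil _ hp.1

lemma subset_of_mem_branchSets {B : Set M.Faces} {S T : Set M.Edges}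
    (hS : S ∈ M.dualGraph.branchSets B) (hT : T ∈ M.dualGraph.branchSets B)
    {e : M.Edges} (heS : e ∈ S) (heT : e ∈ T) : S ⊆ T := by
  obtain ⟨u, v, -, -, p, hp, rfl⟩ := hS
  obtain ⟨u', v', -, -, p', hp', rfl⟩ := hT
  exact hp.forall_mem_edges (C := fun e => e ∈ p'.edges)
    (fun a b x hdeg _ ha hb _ _ h => hp'.mem_edges_of_mem_ends h ha hdeg hb) heS heT

/-- Distinct branches are edge-disjoint. -/
lemma eq_of_mem_branchSets {B : Set M.Faces} {S T : Set M.Edges}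
    (hS : S ∈ M.dualGraph.branchSets B) (hT : T ∈ M.dualGraph.branchSets B)
    {e : M.Edges} (heS : e ∈ S) (heT : e ∈ T) : S = T :=
  (subset_of_mem_branchSets hS hT heS heT).antisymm (subset_of_mem_branchSets hT hS heT heS)

lemma eq_univ_of_stable (hconn : M.Conn) {A : Set D} {d : D} (hd : d ∈ A)
    (hσ : ∀ d ∈ A, M.σ d ∈ A) (hα : ∀ d ∈ A, M.α d ∈ A) (d' : D) : d' ∈ A := by
  have h := hconn d d'
  induction h with
  | refl => exact hd
  | tail _ hstep ih =>
    rcases hstep with rfl | rfl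
    exacts [hσ _ ih, hα _ ih]

end CombMap

namespace CombMap

open Classical in
/-- The boundary map of the dual graph modulo 2. -/
noncomputable def boundary {D : Type} [Fintype D] (M : CombMap D) :
    (M.Edges → ZMod 2) →ₗ[ZMod 2] (M.Faces → ZMod 2) where
  toFun c f := ∑ d, if M.fmk d = f then c (M.emk d) else 0
  map_add' c c' := by
    ext f
    simp only [Pi.add_apply, ← Finset.sum_add_distrib]
    refine Finset.sum_congr rfl fun d _ => ?_
    split_ifs <;> simp
  map_smul' a c := by
    ext f
    simp only [Pi.smul_apply, smul_eq_mul, RingHom.id_apply, Finset.mul_sum]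
    refine Finset.sum_congr rfl fun d _ => ?_
    split_ifs <;> simp

/-- The coboundary map of a multigraph modulo 2. -/
def _root_.Multigraph.coboundary {V E : Type} (G : Multigraph V E) :
    (V → ZMod 2) →ₗ[ZMod 2] (E → ZMod 2) where
  toFun y e := (G.ends e).lift ⟨fun a b => y a + y b, fun _ _ => add_comm _ _⟩
  map_add' y y' := by
    ext e
    simp only [Pi.add_apply]
    induction G.ends e with
    | _ a b => simp only [Sym2.lift_mk]; ring
  map_smul' r y := by
    ext e
    simp only [Pi.smul_apply, smul_eq_mul, RingHom.id_apply]
    induction G.ends e with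
    | _ a b => simp only [Sym2.lift_mk]; ring

lemma _root_.Multigraph.coboundary_apply {V E : Type} {G : Multigraph V E} {e : E} {a b : V}
    (h : G.ends e = s(a, b)) (y : V → ZMod 2) : G.coboundary y e = y a + y b := by
  change (G.ends e).lift _ = _
  rw [h]; rfl

variable {D : Type} [Fintype D] {M : CombMap D}

open Classical in
lemma boundary_apply (c : M.Edges → ZMod 2) (f : M.Faces) :
    M.boundary c f = ∑ d, if M.fmk d = f then c (M.emk d) else 0 := rfl

lemma boundary_coboundary (y : M.Vertices → ZMod 2) :
    M.boundary (M.toMultigraph.coboundary y) = 0 := by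
  classical
  ext f
  simp only [boundary_apply, Multigraph.coboundary_apply (ends_emk _), Pi.zero_apply]
  have h : ∑ d, (if M.fmk d = f then y (M.vmk (M.α d)) else 0) =
      ∑ d, if M.fmk d = f then y (M.vmk d) else 0 := by
    refine Fintype.sum_equiv M.φ _ _ fun d => ?_
    rw [fmk_φ, vmk_φ]
  have hsplit : ∀ d, (if M.fmk d = f then y (M.vmk d) + y (M.vmk (M.α d)) else 0) =
      (if M.fmk d = f then y (M.vmk d) else 0) +
        if M.fmk d = f then y (M.vmk (M.α d)) else 0 := by
    intro d
    split_ifs <;> simp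
  rw [Finset.sum_congr rfl fun d _ => hsplit d, Finset.sum_add_distrib, h,
    CharTwo.add_self_eq_zero]

lemma sum_emk_fiber [DecidableEq M.Edges] (d : D) (g : D → ZMod 2) :
    (∑ c, if M.emk c = M.emk d then g c else 0) = g d + g (M.α d) := by
  classical
  rw [← Finset.sum_filter, ← Finset.sum_pair (M.α_ne d).symm]
  refine Finset.sum_congr ?_ fun _ _ => rfl
  ext c
  simp only [Finset.mem_filter, Finset.mem_univ, true_and, Finset.mem_insert,
    Finset.mem_singleton]
  rw [eq_comm, emk_eq_iff]

lemma boundary_single [DecidableEq M.Edges] [DecidableEq M.Faces] {e : M.Edges} {a b : M.Faces}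
    (h : M.dualGraph.ends e = s(a, b)) :
    M.boundary (Pi.single e 1) = Pi.single a 1 + Pi.single b 1 := by
  obtain ⟨d, rfl⟩ := emk_surjective e
  have key : M.boundary (Pi.single (M.emk d) 1) =
      Pi.single (M.fmk d) 1 + Pi.single (M.fmk (M.α d)) 1 := by
    ext f
    have := sum_emk_fiber (M := M) d (fun c => if M.fmk c = f then 1 else 0)
    simp only [boundary_apply, Pi.add_apply, Pi.single_apply, @eq_comm _ f]
    rw [← this]
    refine Finset.sum_congr rfl fun c _ => ?_
    split_ifs <;> rfl
  rw [key]
  rw [dualGraph_ends_emk, Sym2.eq_iff] at h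
  rcases h with ⟨rfl, rfl⟩ | ⟨rfl, rfl⟩
  exacts [rfl, add_comm _ _]

lemma card_darts (M : CombMap D) : Fintype.card D = 2 * Nat.card M.Edges := by
  have h := Set.ncard_preimage_eq_two_mul M.emk Set.univ (fun e _ => ncard_emk_fiber e)
  rwa [Set.preimage_univ, Set.ncard_univ, Set.ncard_univ, Nat.card_eq_fintype_card] at h

/-- The kernel of the coboundary map of a connected graph consists of constants. -/
lemma finrank_ker_coboundary_le {V E : Type} [Finite V] [Nonempty V] {G : Multigraph V E}
    (h : ∀ y : V → ZMod 2, G.coboundary y = 0 → ∀ u v, y u = y v) :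
    Module.finrank (ZMod 2) (LinearMap.ker G.coboundary) ≤ 1 := by
  have hle : LinearMap.ker G.coboundary ≤ Submodule.span (ZMod 2) {fun _ : V => (1 : ZMod 2)} := by
    intro y hy
    rw [Submodule.mem_span_singleton]
    refine ⟨y (Classical.arbitrary V), ?_⟩
    ext v
    simpa using h y hy _ v
  exact (Submodule.finrank_mono hle).trans ((finrank_span_le_card _).trans (by simp))

lemma vertex_const (hconn : M.Conn) (y : M.Vertices → ZMod 2)
    (hy : M.toMultigraph.coboundary y = 0) (u v : M.Vertices) : y u = y v := by
  obtain ⟨d, rfl⟩ := vmk_surjective u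
  obtain ⟨d', rfl⟩ := vmk_surjective v
  refine eq_univ_of_stable hconn (A := {c | y (M.vmk d) = y (M.vmk c)}) rfl ?_ ?_ d'
  · intro c hc
    have : M.vmk (M.σ c) = M.vmk c :=
      (vmk_eq_iff.2 ((Equiv.Perm.SameCycle.refl _ _).apply_right)).symm
    exact hc.trans (congrArg y this.symm)
  · intro c hc
    have h := congrFun hy (M.emk c)
    rw [Multigraph.coboundary_apply (ends_emk c)] at h
    exact Eq.trans hc (CharTwo.add_eq_zero.1 h)

lemma face_const (hconn : M.Conn) (y : M.Faces → ZMod 2)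
    (hy : M.dualGraph.coboundary y = 0) (u v : M.Faces) : y u = y v := by
  obtain ⟨d, rfl⟩ := fmk_surjective u
  obtain ⟨d', rfl⟩ := fmk_surjective v
  have hα : ∀ c ∈ {c | y (M.fmk d) = y (M.fmk c)}, M.α c ∈ {c | y (M.fmk d) = y (M.fmk c)} := by
    intro c hc
    have h := congrFun hy (M.emk c)
    rw [Multigraph.coboundary_apply (dualGraph_ends_emk c)] at h
    exact Eq.trans hc (CharTwo.add_eq_zero.1 h)
  refine eq_univ_of_stable hconn (A := {c | y (M.fmk d) = y (M.fmk c)}) rfl ?_ hα d'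
  intro c hc
  have h1 := hα c hc
  have h2 : M.fmk (M.σ c) = M.fmk (M.α c) := by
    rw [← fmk_φ (M.α c), φ, Equiv.Perm.mul_apply, M.α_invol]
  exact h1.trans (congrArg y h2.symm)

lemma finrank_range_boundary [Fintype M.Edges] [Fintype M.Faces] :
    Module.finrank (ZMod 2) (LinearMap.range M.boundary) =
      Module.finrank (ZMod 2) (LinearMap.range M.dualGraph.coboundary) := by
  classical
  let A : Matrix M.Faces M.Edges (ZMod 2) :=
    Matrix.of fun f e => ∑ d, if M.fmk d = f ∧ M.emk d = e then 1 else 0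
  have h1 : A.mulVecLin = M.boundary := by
    refine LinearMap.ext fun c => funext fun f => ?_
    change ∑ e, (∑ d, if M.fmk d = f ∧ M.emk d = e then (1 : ZMod 2) else 0) * c e = _
    simp_rw [Finset.sum_mul, boundary_apply]
    rw [Finset.sum_comm]
    refine Finset.sum_congr rfl fun d _ => ?_
    by_cases hd : M.fmk d = f <;> simp [hd]
  have h2 : A.transpose.mulVecLin = M.dualGraph.coboundary := by
    refine LinearMap.ext fun y => funext fun e => ?_
    obtain ⟨d₀, rfl⟩ := emk_surjective e
    rw [Multigraph.coboundary_apply (dualGraph_ends_emk d₀),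
      ← sum_emk_fiber (M := M) d₀ (fun d => y (M.fmk d))]
    change ∑ f, (∑ d, if M.fmk d = f ∧ M.emk d = M.emk d₀ then (1 : ZMod 2) else 0) * y f = _
    simp_rw [Finset.sum_mul]
    rw [Finset.sum_comm]
    refine Finset.sum_congr rfl fun d _ => ?_
    by_cases hd : M.emk d = M.emk d₀ <;> simp [hd]
  rw [← h1, ← h2]
  exact (Matrix.rank_transpose A).symm

/-- In a plane map every dual cycle is a primal cut. -/
lemma exists_coboundary_eq (hconn : M.Conn) (heuler : M.EulerPlanar) [Nonempty D]
    {c : M.Edges → ZMod 2} (hc : M.boundary c = 0) :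
    ∃ y, M.toMultigraph.coboundary y = c := by
  classical
  have := Fintype.ofFinite M.Edges
  have := Fintype.ofFinite M.Faces
  have := Fintype.ofFinite M.Vertices
  have : Nonempty M.Vertices := ⟨M.vmk (Classical.arbitrary D)⟩
  have : Nonempty M.Faces := ⟨M.fmk (Classical.arbitrary D)⟩
  have hV := finrank_ker_coboundary_le (vertex_const hconn)
  have hF := finrank_ker_coboundary_le (face_const hconn)
  have hV' := LinearMap.finrank_range_add_finrank_ker M.toMultigraph.coboundary
  have hF' := LinearMap.finrank_range_add_finrank_ker M.dualGraph.coboundary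
  have hE' := LinearMap.finrank_range_add_finrank_ker M.boundary
  rw [finrank_range_boundary] at hE'
  simp only [Module.finrank_fintype_fun_eq_card, ← Nat.card_eq_fintype_card] at hV' hF' hE'
  have hD := card_darts M
  have heuler' : (Nat.card M.Vertices : ℤ) + Nat.card M.Faces = (Fintype.card D / 2 : ℕ) + 2 :=
    heuler
  have hle : LinearMap.range M.toMultigraph.coboundary ≤ LinearMap.ker M.boundary := by
    rintro _ ⟨y, rfl⟩
    exact boundary_coboundary y
  have heq := Submodule.eq_of_le_of_finrank_le hle (by omega)
  have hmem : c ∈ LinearMap.range M.toMultigraph.coboundary := by rw [heq]; exact hc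
  exact hmem

end CombMap

/-- The vertices of `G` up to connection by edges outside `S`. -/
def Multigraph.reachSetoid {V E : Type} (G : Multigraph V E) (S : Set E) : Setoid V where
  r := G.Reach ∅ S
  iseqv := by
    refine ⟨fun _ => Relation.ReflTransGen.refl, fun h => ?_, fun h h' => h.trans h'⟩
    have : Std.Symm (G.AdjAvoid ∅ S) :=
      ⟨fun _ _ ⟨ha, hb, e, he, hab⟩ => ⟨hb, ha, e, he, hab.trans Sym2.eq_swap⟩⟩
    exact Relation.ReflTransGen.stdSymm.symm _ _ h

lemma Multigraph.reachSetoid_of_ends {V E : Type} {G : Multigraph V E} {S : Set E} {e : E}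
    (he : e ∉ S) {a b : V} (h : G.ends e = s(a, b)) : G.reachSetoid S a b :=
  Relation.ReflTransGen.single ⟨Set.notMem_empty a, Set.notMem_empty b, e, he, h⟩

namespace CombMap

variable {D : Type} [Fintype D] {M : CombMap D}

open Classical in
lemma boundary_indicator_branch {B : Set M.Faces} {S : Set M.Edges}
    (hS : S ∈ M.dualGraph.branchSets B) : ∃ u ∈ B, ∃ v ∈ B,
      M.boundary (S.indicator 1) = Pi.single u 1 + Pi.single v 1 := by
  obtain ⟨u, v, hu, hv, p, -, rfl⟩ := hS
  refine ⟨u, hu, v, hv, ?_⟩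
  rw [← p.sum_boundary (fun e => M.boundary (Pi.single e 1)) fun e a b h => boundary_single h,
    ← map_sum]
  congr 1
  ext e
  simp [Finset.sum_apply, Pi.single_apply, Set.indicator_apply]

/-- Each independent dual cycle formed by branches splits off one more part of the primal. -/
lemma ncard_branchSets_add_two_le (hconn : M.Conn) (heuler : M.EulerPlanar) [Nonempty D]
    {B : Set M.Faces} (hB : B.Nonempty) :
    (M.dualGraph.branchSets B).ncard + 2 ≤ B.ncard + Nat.card
      (Quotient (M.toMultigraph.reachSetoid (⋃₀ M.dualGraph.branchSets B))) := by
  classical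
  set 𝓑 := M.dualGraph.branchSets B
  set r := M.toMultigraph.reachSetoid (⋃₀ 𝓑)
  have := Fintype.ofFinite 𝓑
  have := Fintype.ofFinite B
  have := Fintype.ofFinite (Quotient r)
  have := Fintype.ofFinite M.Edges
  let L : (𝓑 → ZMod 2) →ₗ[ZMod 2] (M.Edges → ZMod 2) :=
    Fintype.linearCombination (ZMod 2) fun S : 𝓑 => (S : Set M.Edges).indicator 1
  have hL : ∀ x, L x = ∑ S : 𝓑, x S • (S : Set M.Edges).indicator 1 := fun x => rfl
  have hLmem : ∀ x (S : 𝓑), ∀ e ∈ (S : Set M.Edges), L x e = x S := by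
    intro x S e he
    rw [hL, Finset.sum_apply, Finset.sum_eq_single S]
    · simp [he]
    · intro T _ hTS
      have : e ∉ (T : Set M.Edges) := fun heT =>
        hTS (Subtype.ext (eq_of_mem_branchSets T.2 S.2 heT he))
      simp [this]
    · simp
  have hLout : ∀ x e, e ∉ ⋃₀ 𝓑 → L x e = 0 := by
    intro x e he
    rw [hL, Finset.sum_apply]
    refine Finset.sum_eq_zero fun T _ => ?_
    have : e ∉ (T : Set M.Edges) := fun heT => he ⟨T, T.2, heT⟩
    simp [this]
  have hLinj : Function.Injective L := by
    intro x x' h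
    ext S
    obtain ⟨e, he⟩ := nonempty_of_mem_branchSets S.2
    rw [← hLmem x S e he, ← hLmem x' S e he, h]
  have hbd : ∀ x, (∀ f ∉ B, M.boundary (L x) f = 0) ∧ ∑ f : B, M.boundary (L x) f = 0 := by
    intro x
    have hone : ∀ S : 𝓑, (∀ f ∉ B, M.boundary ((S : Set M.Edges).indicator 1) f = 0) ∧
        ∑ f : B, M.boundary ((S : Set M.Edges).indicator 1) f = 0 := by
      intro S
      obtain ⟨u, hu, v, hv, h⟩ := boundary_indicator_branch S.2
      have hsum : ∀ w ∈ B, ∑ f : B, (Pi.single w 1 : M.Faces → ZMod 2) f = 1 := by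
        intro w hw
        rw [Finset.sum_eq_single ⟨w, hw⟩] <;> simp +contextual [Subtype.ext_iff]
      constructor
      · intro f hf
        have hfu : f ≠ u := fun h => hf (h ▸ hu)
        have hfv : f ≠ v := fun h => hf (h ▸ hv)
        simp [h, hfu, hfv]
      · simp only [h, Pi.add_apply, Finset.sum_add_distrib, hsum u hu, hsum v hv]
        exact CharTwo.add_self_eq_zero _
    simp only [hL, map_sum, map_smul, Finset.sum_apply, Pi.smul_apply, smul_eq_mul]
    constructor
    · intro f hf
      exact Finset.sum_eq_zero fun S _ => by rw [(hone S).1 f hf, mul_zero]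
    · rw [Finset.sum_comm]
      exact Finset.sum_eq_zero fun S _ => by rw [← Finset.mul_sum, (hone S).2, mul_zero]
  let Φ : (𝓑 → ZMod 2) →ₗ[ZMod 2] (B → ZMod 2) :=
    LinearMap.funLeft (ZMod 2) (ZMod 2) (Subtype.val : B → M.Faces) ∘ₗ M.boundary ∘ₗ L
  have hΦ : ∀ x f, Φ x f = M.boundary (L x) f := fun _ _ => rfl
  have hrange : Module.finrank (ZMod 2) (LinearMap.range Φ) < B.ncard := by
    have hlt : LinearMap.range Φ < ⊤ := by
      refine lt_top_iff_ne_top.2 fun htop => ?_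
      obtain ⟨w, hw⟩ := hB
      have hmem : (Pi.single ⟨w, hw⟩ 1 : B → ZMod 2) ∈ LinearMap.range Φ := by rw [htop]; trivial
      obtain ⟨x, hx⟩ := hmem
      have h0 := (hbd x).2
      simp only [← hΦ, hx, Finset.sum_pi_single', Finset.mem_univ, if_true] at h0
      simp at h0
    have := Submodule.finrank_lt hlt.ne
    rwa [Module.finrank_fintype_fun_eq_card, ← Nat.card_eq_fintype_card] at this
  let δ : (Quotient r → ZMod 2) →ₗ[ZMod 2] (M.Edges → ZMod 2) :=
    M.toMultigraph.coboundary ∘ₗ LinearMap.funLeft (ZMod 2) (ZMod 2) (Quotient.mk r)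
  have hker : (LinearMap.ker Φ).map L ≤ LinearMap.range δ := by
    rintro _ ⟨x, hx, rfl⟩
    have h0 : M.boundary (L x) = 0 := by
      ext f
      by_cases hf : f ∈ B
      · exact congrFun (LinearMap.mem_ker.1 hx) ⟨f, hf⟩
      · exact (hbd x).1 f hf
    obtain ⟨y, hy⟩ := exists_coboundary_eq hconn heuler h0
    have hconst : ∀ a b, r a b → y a = y b := by
      intro a b hab
      induction hab with
      | refl => rfl
      | tail _ hstep ih =>
        obtain ⟨-, -, e, he, hab⟩ := hstep
        have h1 := hLout x e he
        rw [← hy, Multigraph.coboundary_apply hab] at h1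
        exact ih.trans (CharTwo.add_eq_zero.1 h1)
    exact ⟨Quotient.lift y hconst, hy⟩
  have hδ : 1 ≤ Module.finrank (ZMod 2) (LinearMap.ker δ) := by
    rw [Nat.one_le_iff_ne_zero, Ne, Submodule.finrank_eq_zero]
    intro hbot
    have hmem : (fun _ => 1 : Quotient r → ZMod 2) ∈ LinearMap.ker δ := by
      rw [LinearMap.mem_ker]
      ext e
      obtain ⟨d, rfl⟩ := emk_surjective e
      change M.toMultigraph.coboundary _ (M.emk d) = _
      rw [Multigraph.coboundary_apply (ends_emk d)]
      exact CharTwo.add_self_eq_zero _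
    rw [hbot, Submodule.mem_bot] at hmem
    exact one_ne_zero (congrFun hmem (Quotient.mk r (M.vmk (Classical.arbitrary D))))
  have h1 := LinearMap.finrank_range_add_finrank_ker Φ
  have h2 := LinearMap.finrank_range_add_finrank_ker δ
  have h3 := Submodule.finrank_mono hker
  rw [← (Submodule.equivMapOfInjective L hLinj _).finrank_eq] at h3
  rw [Module.finrank_fintype_fun_eq_card, ← Nat.card_eq_fintype_card] at h1 h2
  rw [← Nat.card_coe_set_eq 𝓑]
  omega

variable (M) in
/-- The edge set `S` contains an edge joining a part of the partition `r` to another part. -/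
def Crosses (r : Setoid M.Vertices) (W : Quotient r) (S : Set M.Edges) : Prop :=
  ∃ e ∈ S, ∃ a b, M.toMultigraph.ends e = s(a, b) ∧ Quotient.mk r a = W ∧ Quotient.mk r b ≠ W

/-- Every part meets at least three branches, counting anchor vertices as well. -/
lemma three_le_crosses_add_anchor (h2c : M.toMultigraph.TwoConnected)
    (hcard : 4 ≤ Nat.card M.Vertices) {Z : Set M.Vertices}
    (hZ : M.toMultigraph.IsAnchor Z) {B : Set M.Faces}
    {r : Setoid M.Vertices} (hr : r = M.toMultigraph.reachSetoid (⋃₀ M.dualGraph.branchSets B))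
    (W : Quotient r) (hW : ∃ W', W' ≠ W) :
    3 ≤ {S | S ∈ M.dualGraph.branchSets B ∧ M.Crosses r W S}.ncard +
      {z | z ∈ Z ∧ Quotient.mk r z = W}.ncard := by
  obtain ⟨x, hx⟩ := Quotient.exists_rep W
  obtain ⟨y, hy⟩ : ∃ y, Quotient.mk r y ≠ W := by
    obtain ⟨W', hW'⟩ := hW
    obtain ⟨y, rfl⟩ := Quotient.exists_rep W'
    exact ⟨y, hW'⟩
  let A : Set M.Vertices := {a | Quotient.mk r a = W}
  have hbranch : ∀ e a b, M.toMultigraph.ends e = s(a, b) → a ∈ A → b ∉ A →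
      ∃ S ∈ {S | S ∈ M.dualGraph.branchSets B ∧ M.Crosses r W S}, e ∈ S := by
    intro e a b he ha hb
    have hmem : e ∈ ⋃₀ M.dualGraph.branchSets B := by
      by_contra hcon
      refine hb (Eq.trans ?_ ha)
      refine (Quotient.sound ?_).symm
      rw [hr]
      exact Multigraph.reachSetoid_of_ends hcon he
    obtain ⟨S, hS, heS⟩ := hmem
    exact ⟨S, ⟨hS, e, heS, a, b, he, ha, hb⟩, heS⟩
  obtain ⟨e₁, u, v, he₁, hu, hv, -⟩ :=
    h2c.exists_crossing_ne (W := A) hx hy s(x, x)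
  obtain ⟨e₂, u', v', he₂, hu', hv', hne⟩ := h2c.exists_crossing_ne (W := A) hx hy s(u, v)
  obtain ⟨S₁, hS₁, heS₁⟩ := hbranch _ _ _ he₁ hu hv
  obtain ⟨S₂, hS₂, heS₂⟩ := hbranch _ _ _ he₂ hu' hv'
  have hS : S₁ ≠ S₂ := by
    rintro rfl
    exact hne ((ends_eq_of_mem_branchSets hS₁.1 heS₂ heS₁).trans he₁)
  have hsub : {S₁, S₂} ⊆ {S | S ∈ M.dualGraph.branchSets B ∧ M.Crosses r W S} := by
    rintro S (rfl | rfl) <;> assumption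
  have hle := Set.ncard_le_ncard hsub
  rw [Set.ncard_pair hS] at hle
  by_contra hcon
  have heq := Set.eq_of_subset_of_ncard_le hsub (by rw [Set.ncard_pair hS]; omega)
  obtain ⟨z, hz, hzA⟩ : ∃ z ∈ Z, z ∈ A := by
    refine hZ.exists_mem_of_two_classes h2c hcard hu hv hu' hv'
      (fun h => hne (he₂.trans h.symm)) fun e c d he hc hd => ?_
    have key : ∀ {a b : M.Vertices}, a ∈ A → b ∉ A → M.toMultigraph.ends e = s(a, b) →
        c = a ∧ d = b := by
      intro a b ha hb h
      rw [he, Sym2.eq_iff] at h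
      rcases h with h | ⟨rfl, rfl⟩
      exacts [h, absurd hc hb]
    obtain ⟨S, hS, heS⟩ := hbranch e c d he hc hd
    rw [← heq] at hS
    rcases hS with rfl | rfl
    · exact Or.inl (key hu hv ((ends_eq_of_mem_branchSets hS₁.1 heS heS₁).trans he₁))
    · exact Or.inr (key hu' hv' ((ends_eq_of_mem_branchSets hS₂.1 heS heS₂).trans he₂))
  have : 0 < {z | z ∈ Z ∧ Quotient.mk r z = W}.ncard := (Set.ncard_pos (Set.toFinite _)).2 ⟨z, hz, hzA⟩
  omega

lemma ncard_crossed_le_two {B : Set M.Faces} {S : Set M.Edges}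
    (hS : S ∈ M.dualGraph.branchSets B) (r : Setoid M.Vertices) :
    {W | M.Crosses r W S}.ncard ≤ 2 := by
  obtain ⟨e, he⟩ := nonempty_of_mem_branchSets hS
  obtain ⟨d, rfl⟩ := emk_surjective e
  have hsub : {W | M.Crosses r W S} ⊆
      {Quotient.mk r (M.vmk d), Quotient.mk r (M.vmk (M.α d))} := by
    rintro W ⟨e', he', a, b, hab, rfl, -⟩
    rw [ends_eq_of_mem_branchSets hS he' he, ends_emk, Sym2.eq_iff] at hab
    rcases hab with ⟨rfl, rfl⟩ | ⟨rfl, rfl⟩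
    exacts [Or.inl rfl, Or.inr rfl]
  refine (Set.ncard_le_ncard hsub).trans ((Set.ncard_insert_le _ _).trans ?_)
  rw [Set.ncard_singleton]

lemma ncard_branchSets_le (hconn : M.Conn) (heuler : M.EulerPlanar)
    (h2c : M.toMultigraph.TwoConnected)
    {Z : Set M.Vertices} (hZ : M.toMultigraph.IsAnchor Z) (B : Set M.Faces) :
    (M.dualGraph.branchSets B).ncard ≤ 3 * B.ncard + Z.ncard := by
  classical
  rcases B.eq_empty_or_nonempty with rfl | hB
  · have : M.dualGraph.branchSets ∅ = ∅ := by
      ext S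
      simp [Multigraph.branchSets]
    simp [this]
  have hV := h2c.1
  have : Nonempty D := by
    have : Nonempty M.Vertices := (Nat.card_pos_iff.1 (by omega)).1
    exact ⟨(vmk_surjective (Classical.arbitrary M.Vertices)).choose⟩
  have hBpos : 0 < B.ncard := (Set.ncard_pos (Set.toFinite _)).2 hB
  have hmain := ncard_branchSets_add_two_le hconn heuler hB
  obtain ⟨r, hr⟩ : ∃ r, r = M.toMultigraph.reachSetoid (⋃₀ M.dualGraph.branchSets B) := ⟨_, rfl⟩
  rw [← hr] at hmain
  have hQ : Nat.card (Quotient r) ≤ Nat.card M.Vertices :=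
    Nat.card_le_card_of_surjective _ Quotient.mk_surjective
  by_cases hcard : Nat.card M.Vertices = 3
  · omega
  by_cases hone : Nat.card (Quotient r) ≤ 1
  · omega
  have hnontriv : Nontrivial (Quotient r) :=
    Finite.one_lt_card_iff_nontrivial.1 (by omega)
  have := Fintype.ofFinite (Quotient r)
  have := Fintype.ofFinite (M.dualGraph.branchSets B)
  have := Fintype.ofFinite Z
  have hthree := fun W => three_le_crosses_add_anchor h2c (by omega) hZ hr W
    (exists_ne W)
  have hsum := Finset.sum_le_sum fun W (_ : W ∈ Finset.univ) => hthree W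
  rw [Finset.sum_const, Finset.card_univ, ← Nat.card_eq_fintype_card, smul_eq_mul,
    Finset.sum_add_distrib] at hsum
  have hcross : ∑ W, {S | S ∈ M.dualGraph.branchSets B ∧ M.Crosses r W S}.ncard ≤
      2 * (M.dualGraph.branchSets B).ncard := by
    have hdouble := Finset.sum_card_bipartiteAbove_eq_sum_card_bipartiteBelow
      (s := Finset.univ) (t := (M.dualGraph.branchSets B).toFinset) (M.Crosses r)
    have hA : ∀ W, {S | S ∈ M.dualGraph.branchSets B ∧ M.Crosses r W S}.ncard =
        (Finset.bipartiteAbove (M.Crosses r) (M.dualGraph.branchSets B).toFinset W).card := by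
      intro W
      rw [← Set.ncard_coe_finset]
      congr 1
      ext S
      simp
    rw [Finset.sum_congr rfl fun W _ => hA W, hdouble, mul_comm,
      Set.ncard_eq_toFinset_card', ← smul_eq_mul]
    refine Finset.sum_le_card_nsmul _ _ _ fun S hS => ?_
    refine le_trans (le_of_eq ?_) (ncard_crossed_le_two (Set.mem_toFinset.1 hS) r)
    rw [← Set.ncard_coe_finset]
    congr 1
    ext W
    simp
  have hanchor : ∑ W, {z | z ∈ Z ∧ Quotient.mk r z = W}.ncard = Z.ncard := by
    rw [Set.ncard_eq_toFinset_card' Z, Finset.card_eq_sum_card_fiberwise (f := Quotient.mk r)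
      (t := Finset.univ) (fun _ _ => by simp)]
    refine Finset.sum_congr rfl fun W _ => ?_
    rw [← Set.ncard_coe_finset]
    congr 1
    ext z
    simp
  omega

end CombMap

/-- Let `G` be a 2-connected plane graph with a clean embedding and
anchor `Z`, and let `F'` be a set of faces of length at least 3. Then the number of
branches of the dual graph `G°` with both endpoints in `F'` is at most `3|F'| + |Z|`. -/
theorem statement18 {D : Type} [Fintype D] (M : CombMap D)
    (hconn : M.Conn) (heuler : M.EulerPlanar)
    (h2c : M.toMultigraph.TwoConnected) (hclean : M.IsClean)
    (Z : Set M.Vertices) (hZ : M.toMultigraph.IsAnchor Z)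
    (F' : Set M.dual.Vertices)
    (hF' : ∀ f ∈ F', ∃ d, M.dual.vmk d = f ∧ 3 ≤ M.dual.degreeD d) :
    (M.dual.toMultigraph.branchSets F').ncard ≤ 3 * F'.ncard + Z.ncard := by
  exact CombMap.ncard_branchSets_le hconn heuler h2c hZ F'
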